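/- Every preferred labeling of the JSBAF corresponding to a Deductive ASPIC⊖ argumentation system is closed under sub-arguments: if a ∈ in(L) for a preferred labeling L, then Sub(a) ⊆ in(L). -/

import Mathlib

namespace JS

inductive Lab : Type
  | IN | OUT | UNDEC
deriving DecidableEq

structure JSBAF (A : Type) where
  att : A → A → Prop
  supp : Set A → A → Prop
  pref : A → A → Prop

variable {A : Type}

/-- Strict arguments: supported by the empty set or only by strict arguments. -/
inductive Strict (J : JSBAF A) : A → Prop
  | mk (S : Set A) (a : A) (h : J.supp S a) (hS : ∀ b ∈ S, Strict J b) : Strict J a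

/-- Structural restrictions on JSBAFs. -/
structure Restr (J : JSBAF A) : Prop where
  finSupp : ∀ S b, J.supp S b → S.Finite
  uniqSupp : ∀ S S' b, J.supp S b → J.supp S' b → S = S'
  acyc : ∀ a, ¬ Relation.TransGen (fun x y => ∃ S, J.supp S y ∧ x ∈ S) a a
  strictUnatt : ∀ a b, Strict J b → ¬ J.att a b
  prefRefl : ∀ a, J.pref a a
  prefTrans : ∀ a b c, J.pref a b → J.pref b c → J.pref a c
  prefTotal : ∀ a b, J.pref a b ∨ J.pref b a
  strictEq : ∀ a b, Strict J a → Strict J b → J.pref a b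
  strictTop : ∀ a b, ¬ Strict J a → Strict J b → J.pref a b ∧ ¬ J.pref b a

def inL (L : A → Lab) : Set A := {a | L a = Lab.IN}
def outL (L : A → Lab) : Set A := {a | L a = Lab.OUT}
def undecL (L : A → Lab) : Set A := {a | L a = Lab.UNDEC}

/-- Definition 2, item 1: legally IN. -/
def legallyIn (J : JSBAF A) (L : A → Lab) (a : A) : Prop :=
  (∀ b, J.att b a → L b = Lab.OUT) ∧
  ∀ S c, J.supp S c → a ∈ S → (∀ b ∈ S, b ≠ a → J.pref a b) →
    (L c = Lab.IN ∨
     (L c = Lab.UNDEC ∧ ∃ b ∈ S, b ≠ a ∧ (L b = Lab.OUT ∨ L b = Lab.UNDEC)) ∨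
     (L c = Lab.OUT ∧
       ((∃ b ∈ S, b ≠ a ∧ L b = Lab.OUT) ∨
        (∃ b₁ ∈ S, ∃ b₂ ∈ S, b₁ ≠ a ∧ b₂ ≠ a ∧ b₁ ≠ b₂ ∧
          L b₁ = Lab.UNDEC ∧ L b₂ = Lab.UNDEC))))

/-- Definition 2, item 2: legally OUT. -/
def legallyOut (J : JSBAF A) (L : A → Lab) (a : A) : Prop :=
  (∃ b, J.att b a ∧ L b = Lab.IN) ∨
  (∃ (n : ℕ) (S : ℕ → Set A) (b : ℕ → A),
    (∀ i ≤ n, J.supp (S i) (b i)) ∧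
    (∀ i < n, b i ∈ S (i + 1)) ∧
    a ∈ S 0 ∧
    (∀ d ∈ S 0, d ≠ a → L d = Lab.IN) ∧
    (∃ c, J.att c (b n) ∧ L c = Lab.IN) ∧
    (∀ i ≤ n, L (b i) = Lab.OUT) ∧
    (∀ i, 1 ≤ i → i ≤ n → ∀ d ∈ S i, d ≠ b (i - 1) → L d = Lab.IN) ∧
    (∀ d ∈ S 0, d ≠ a → J.pref a d))

/-- Admissible labelings. -/
def Admissible (J : JSBAF A) (L : A → Lab) : Prop :=
  (∀ a, L a = Lab.IN → legallyIn J L a) ∧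
  (∀ a, L a = Lab.OUT ↔ legallyOut J L a) ∧
  (∀ a, Strict J a → L a = Lab.IN)

/-- Preferred labelings: maximal admissible w.r.t. inclusion of IN-sets. -/
def Preferred (J : JSBAF A) (L : A → Lab) : Prop :=
  Admissible J L ∧ ∀ L', Admissible J L' → ¬ (inL L ⊂ inL L')

/-- The iterated OUT-sets of the SIM labeling. -/
def simO (J : JSBAF A) : ℕ → Set A
  | 0 => {a | ∃ b, Strict J b ∧ J.att b a}
  | n + 1 => simO J n ∪
      {a | ∃ S c, J.supp S c ∧ a ∈ S ∧ c ∈ simO J n ∧ ∀ d ∈ S, d ≠ a → Strict J d}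

def simIn (J : JSBAF A) : Set A := {a | Strict J a}
def simOut (J : JSBAF A) : Set A := ⋃ n, simO J n

open Classical in
/-- The strict-including-minimal labeling. -/
noncomputable def SIM (J : JSBAF A) : A → Lab := fun a =>
  if Strict J a then Lab.IN else if a ∈ simOut J then Lab.OUT else Lab.UNDEC

/-- The order on labelings. -/
def leL (L₁ L₂ : A → Lab) : Prop := inL L₁ ⊆ inL L₂ ∧ outL L₁ ⊆ outL L₂

end JS
namespace ASPIC

/-- An underlying logical language: formulas, atoms, interpretations, a classical
negation and conjunction, and the interpolation-style assumption on syntactically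
disjoint sets of formulas. -/
structure Logic where
  F : Type
  Atom : Type
  atoms : F → Set Atom
  I : Type
  inhab : Nonempty I
  Models : I → F → Prop
  neg : F → F
  conj : F → F → F
  neg_spec : ∀ i φ, Models i (neg φ) ↔ ¬ Models i φ
  conj_spec : ∀ i φ ψ, Models i (conj φ ψ) ↔ (Models i φ ∧ Models i ψ)
  atoms_neg : ∀ φ, atoms (neg φ) = atoms φ
  atoms_conj : ∀ φ ψ, atoms (conj φ ψ) = atoms φ ∪ atoms ψ
  interp : ∀ Γ Δ : Set F, (∀ φ ∈ Γ, ∀ ψ ∈ Δ, atoms φ ∩ atoms ψ = ∅) →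
    (∃ i, ∀ φ ∈ Γ, Models i φ) → (∃ i, ∀ ψ ∈ Δ, Models i ψ) →
    (∃ i, (∀ φ ∈ Γ, Models i φ) ∧ (∀ ψ ∈ Δ, Models i ψ))

/-- The model-based consequence relation ⊨_C. -/
def Conseq (L : Logic) (Γ : Set L.F) (φ : L.F) : Prop :=
  ∀ i, (∀ ψ ∈ Γ, L.Models i ψ) → L.Models i φ

/-- φ = −ψ: one formula is the negation of the other. -/
def negOf (L : Logic) (φ ψ : L.F) : Prop := φ = L.neg ψ ∨ ψ = L.neg φ

/-- Conjunction of a nonempty list of formulas: conjL L φ [ψ₁,…] = φ ∧ ψ₁ ∧ … . -/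
def conjL (L : Logic) : L.F → List L.F → L.F
  | φ, [] => φ
  | φ, ψ :: l => L.conj φ (conjL L ψ l)

/-- A (defeasible) rule: antecedents and conclusion. -/
abbrev Rule (L : Logic) := List L.F × L.F

/-- An argumentation system of Deductive ASPIC⊖: satisfiable axioms, defeasible rules,
a (partial) naming function and a total preorder on defeasible rules.  The strict rules
are the axiomatic rules together with all consequence-based rules. -/
structure ASys (L : Logic) where
  AX : Set L.F
  AX_sat : ∃ i, ∀ φ ∈ AX, L.Models i φ
  Rd : Set (Rule L)
  name : Rule L → Option L.F
  rpref : Rule L → Rule L → Prop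
  rpref_refl : ∀ r, rpref r r
  rpref_trans : ∀ r s t, rpref r s → rpref s t → rpref r t
  rpref_total : ∀ r s, rpref r s ∨ rpref s r

/-- Top-rule kinds: axiomatic, consequence-based strict, defeasible. -/
inductive RK : Type
  | ax | cb | df
deriving DecidableEq

/-- Argument trees (with the kind of the top rule and the conclusion recorded). -/
inductive Arg (L : Logic) : Type
  | node (k : RK) (subs : List (Arg L)) (concl : L.F)

def Arg.concl {L : Logic} : Arg L → L.F
  | .node _ _ φ => φ

def Arg.subs {L : Logic} : Arg L → List (Arg L)
  | .node _ s _ => s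

def Arg.kind {L : Logic} : Arg L → RK
  | .node k _ _ => k

/-- Well-formed arguments of an argumentation system. -/
inductive Wf (L : Logic) (as : ASys L) : Arg L → Prop
  | ax (φ : L.F) (h : φ ∈ as.AX) : Wf L as (.node .ax [] φ)
  | cb (subs : List (Arg L)) (φ : L.F) (hs : ∀ a ∈ subs, Wf L as a)
      (h : Conseq L {ψ | ∃ a ∈ subs, Arg.concl a = ψ} φ) : Wf L as (.node .cb subs φ)
  | df (subs : List (Arg L)) (φ : L.F) (hs : ∀ a ∈ subs, Wf L as a)
      (h : (subs.map Arg.concl, φ) ∈ as.Rd) : Wf L as (.node .df subs φ)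

/-- Sub-argument relation: `Sub a b` means a is a sub-argument of b. -/
inductive Sub (L : Logic) : Arg L → Arg L → Prop
  | refl (a : Arg L) : Sub L a a
  | step (a b : Arg L) (k : RK) (subs : List (Arg L)) (φ : L.F)
      (hb : b ∈ subs) (h : Sub L a b) : Sub L a (.node k subs φ)

/-- Conclusions of the sub-arguments of a. -/
def SubC (L : Logic) (a : Arg L) : Set L.F := {φ | ∃ b, Sub L b a ∧ Arg.concl b = φ}

/-- Axiomatic and defeasible sub-arguments. -/
def ADSub (L : Logic) (a : Arg L) : Set (Arg L) := {b | Sub L b a ∧ Arg.kind b ≠ RK.cb}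

/-- Conclusions of the axiomatic and defeasible sub-arguments. -/
def ADSubC (L : Logic) (a : Arg L) : Set L.F :=
  {φ | ∃ b, Sub L b a ∧ Arg.kind b ≠ RK.cb ∧ Arg.concl b = φ}

/-- Defeasible rules used in an argument. -/
def DR (L : Logic) (a : Arg L) : Set (Rule L) :=
  {r | ∃ subs, Sub L (Arg.node RK.df subs r.2) a ∧ r.1 = subs.map Arg.concl}

/-- Strict arguments: no defeasible rules used. -/
def IsStrictArg (L : Logic) (a : Arg L) : Prop := DR L a = ∅

/-- Elitist weakest-link lifting of the rule preorder to arguments (a ⪯_ewl b). -/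
def ewl (L : Logic) (as : ASys L) (a b : Arg L) : Prop :=
  (DR L a = ∅ ∧ DR L b = ∅) ∨ ∃ ra ∈ DR L a, ∀ rb ∈ DR L b, as.rpref ra rb

/-- a undercuts b: the conclusion of a is the negation of the name of a defeasible rule
used in b. -/
def Undercuts (L : Logic) (as : ASys L) (a b : Arg L) : Prop :=
  ∃ subs φ, Sub L (Arg.node RK.df subs φ) b ∧
    ∃ nm, as.name (subs.map Arg.concl, φ) = some nm ∧ negOf L (Arg.concl a) nm

/-- a gen-rebuts b: b is defeasible and the conclusion of a is the negation of a conjunction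
of conclusions of sub-arguments of b. -/
def GenRebuts (L : Logic) (a b : Arg L) : Prop :=
  DR L b ≠ ∅ ∧ ∃ (φ : L.F) (l : List L.F),
    (∀ χ ∈ φ :: l, χ ∈ SubC L b) ∧ Arg.concl a = L.neg (conjL L φ l)

/-- a defeats b: a undercuts b, or a gen-rebuts b and a is not strictly weaker than b. -/
def Defeats (L : Logic) (as : ASys L) (a b : Arg L) : Prop :=
  Undercuts L as a b ∨
    (GenRebuts L a b ∧ ¬ (ewl L as a b ∧ ¬ ewl L as b a))

/-- The strict rules of an argumentation system: axiomatic or consequence-based. -/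
def StrictRule (L : Logic) (as : ASys L) (r : Rule L) : Prop :=
  (r.1 = [] ∧ r.2 ∈ as.AX) ∨ Conseq L {φ | φ ∈ r.1} r.2

end ASPIC

namespace ASPIC

/-- The well-formed arguments of an argumentation system. -/
def WfArg (L : Logic) (as : ASys L) : Type := {a : Arg L // Wf L as a}

/-- The JSBAF corresponding to an argumentation system: attacks are defeats, supports are
applications of strict rules, preferences are the elitist weakest-link lifting. -/
def toJ (L : Logic) (as : ASys L) : JS.JSBAF (WfArg L as) where
  att a b := Defeats L as a.1 b.1
  supp S b := (Arg.kind b.1 = RK.ax ∨ Arg.kind b.1 = RK.cb) ∧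
    S = {a : WfArg L as | a.1 ∈ Arg.subs b.1}
  pref a b := ewl L as a.1 b.1

/-- The conclusions of the IN-arguments of a labeling. -/
def concls (L : Logic) (as : ASys L) (Lb : WfArg L as → JS.Lab) : Set L.F :=
  {φ | ∃ a : WfArg L as, Lb a = JS.Lab.IN ∧ Arg.concl a.1 = φ}

/-- The AS is consistent: no two strict arguments have contradictory conclusions. -/
def ASConsistent (L : Logic) (as : ASys L) : Prop :=
  ¬ ∃ a b : Arg L, Wf L as a ∧ Wf L as b ∧ DR L a = ∅ ∧ DR L b = ∅ ∧
      negOf L (Arg.concl a) (Arg.concl b)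

end ASPIC

namespace ASPIC

theorem Sub.trans' {L : Logic} {a b c : Arg L} (h1 : Sub L a b) (h2 : Sub L b c) : Sub L a c := by
  induction h2 with
  | refl => exact h1
  | step _ k subs φ hb _ ih => exact Sub.step _ _ k subs φ hb ih

theorem sub_node {L : Logic} {z : Arg L} {k : RK} {s : List (Arg L)} {φ : L.F} :
    Sub L z (.node k s φ) ↔ z = .node k s φ ∨ ∃ b ∈ s, Sub L z b := by
  constructor
  · intro h
    cases h with
    | refl => exact Or.inl rfl
    | step b _ _ _ hb h => exact Or.inr ⟨b, hb, h⟩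
  · rintro (rfl | ⟨b, hb, h⟩)
    · exact Sub.refl _
    · exact Sub.step _ _ _ _ _ hb h

theorem sub_of_mem {L : Logic} {a b : Arg L} (h : a ∈ b.subs) : Sub L a b := by
  cases b with
  | node k s φ => exact Sub.step _ _ _ _ _ h (Sub.refl _)

theorem sub_ad {L : Logic} {z b : Arg L} (hb : b.kind = RK.cb) (h : Sub L z b)
    (hz : z.kind ≠ RK.cb) : ∃ d ∈ b.subs, Sub L z d := by
  cases b with
  | node k s φ =>
    rcases sub_node.1 h with rfl | h
    · exact absurd hb hz
    · exact h

theorem Wf.sub {L : Logic} {as : ASys L} {a b : Arg L} (hb : Wf L as b) (h : Sub L a b) :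
    Wf L as a := by
  induction h with
  | refl => exact hb
  | step _ k subs φ hmem _ ih =>
    apply ih
    cases hb with
    | ax => simp at hmem
    | cb _ _ hs => exact hs _ hmem
    | df _ _ hs => exact hs _ hmem

theorem sub_finite {L : Logic} {as : ASys L} {a : Arg L} (ha : Wf L as a) :
    {z | Sub L z a}.Finite := by
  have key : ∀ (k : RK) (s : List (Arg L)) (φ : L.F), (∀ b ∈ s, {z | Sub L z b}.Finite) →
      {z | Sub L z (.node k s φ)}.Finite := by
    intro k s φ h
    have : {z | Sub L z (.node k s φ)} = {.node k s φ} ∪ ⋃ b ∈ {b | b ∈ s}, {z | Sub L z b} := by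
      ext z
      simp [sub_node]
    rw [this]
    exact (Set.finite_singleton _).union (Set.Finite.biUnion (List.finite_toSet s) h)
  induction ha with
  | ax φ h => exact key _ _ _ (by simp)
  | cb subs φ hs h ih => exact key _ _ _ ih
  | df subs φ hs h ih => exact key _ _ _ ih

theorem DR_mono_cov {L : Logic} {e x : Arg L}
    (h : ∀ z, Sub L z x → z.kind ≠ RK.cb → Sub L z e) : DR L x ⊆ DR L e := by
  rintro r ⟨s, hs, hr⟩
  exact ⟨s, h _ hs (by simp [Arg.kind]), hr⟩

theorem DR_finite {L : Logic} {as : ASys L} {a : Arg L} (ha : Wf L as a) : (DR L a).Finite := by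
  refine ((sub_finite ha).image (fun z => (z.subs.map Arg.concl, z.concl))).subset ?_
  rintro ⟨r1, r2⟩ ⟨s, hs, hr⟩
  exact ⟨_, hs, by simp [Arg.subs, Arg.concl]; exact hr.symm⟩

theorem exists_min {L : Logic} (as : ASys L) {s : Set (Rule L)} (hs : s.Finite) :
    s.Nonempty → ∃ r ∈ s, ∀ r' ∈ s, as.rpref r r' := by
  induction s, hs using Set.Finite.induction_on with
  | empty => intro h; simp at h
  | @insert a s _ _ ih =>
    intro _
    rcases s.eq_empty_or_nonempty with rfl | hne
    · exact ⟨a, by simp, by simp [as.rpref_refl]⟩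
    · obtain ⟨r, hr, hmin⟩ := ih hne
      rcases as.rpref_total a r with h | h
      · refine ⟨a, by simp, ?_⟩
        rintro r' (rfl | h')
        · exact as.rpref_refl _
        · exact as.rpref_trans _ _ _ h (hmin _ h')
      · refine ⟨r, by simp [hr], ?_⟩
        rintro r' (rfl | h')
        · exact h
        · exact hmin _ h'

theorem ewl_total {L : Logic} {as : ASys L} {a b : Arg L} (ha : Wf L as a) (hb : Wf L as b) :
    ewl L as a b ∨ ewl L as b a := by
  rcases (DR L a).eq_empty_or_nonempty with hae | hane
  · rcases (DR L b).eq_empty_or_nonempty with hbe | ⟨r, hr⟩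
    · exact Or.inl (Or.inl ⟨hae, hbe⟩)
    · exact Or.inr (Or.inr ⟨r, hr, by simp [hae]⟩)
  · obtain ⟨ra, hra, hma⟩ := exists_min as (DR_finite ha) hane
    rcases (DR L b).eq_empty_or_nonempty with hbe | hbne
    · exact Or.inl (Or.inr ⟨ra, hra, by simp [hbe]⟩)
    · obtain ⟨rb, hrb, hmb⟩ := exists_min as (DR_finite hb) hbne
      rcases as.rpref_total ra rb with h | h
      · exact Or.inl (Or.inr ⟨ra, hra, fun r hr => as.rpref_trans _ _ _ h (hmb r hr)⟩)
      · exact Or.inr (Or.inr ⟨rb, hrb, fun r hr => as.rpref_trans _ _ _ h (hma r hr)⟩)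

theorem models_conjL {L : Logic} (i : L.I) (φ : L.F) (l : List L.F) :
    L.Models i (conjL L φ l) ↔ ∀ χ ∈ φ :: l, L.Models i χ := by
  induction l generalizing φ with
  | nil => simp [conjL]
  | cons ψ l ih => simp only [conjL, L.conj_spec, ih]; simp

theorem sound_concl {L : Logic} {as : ASys L} {x : Arg L} (hx : Wf L as x) (i : L.I)
    (h : ∀ z, Sub L z x → z.kind ≠ RK.cb → L.Models i z.concl) : L.Models i x.concl := by
  induction hx with
  | ax φ _ => exact h _ (Sub.refl _) (by simp [Arg.kind])
  | df subs φ hs _ ih => exact h _ (Sub.refl _) (by simp [Arg.kind])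
  | cb subs φ hs hc ih =>
    apply hc i
    rintro ψ ⟨a, ha, rfl⟩
    exact ih a ha (fun z hz hk => h z (Sub.step _ _ _ _ _ ha hz) hk)

theorem sound_subC {L : Logic} {as : ASys L} {x : Arg L} (hx : Wf L as x) (i : L.I)
    (h : ∀ z, Sub L z x → z.kind ≠ RK.cb → L.Models i z.concl) :
    ∀ χ ∈ SubC L x, L.Models i χ := by
  rintro χ ⟨b, hb, rfl⟩
  exact sound_concl (hx.sub hb) i (fun z hz hk => h z (hz.trans' hb) hk)

theorem strict_of_DR {L : Logic} {as : ASys L} {x : Arg L} (hx : Wf L as x) :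
    DR L x = ∅ → JS.Strict (toJ L as) ⟨x, hx⟩ := by
  induction hx with
  | ax φ h =>
    intro _
    exact JS.Strict.mk _ _ ⟨Or.inl rfl, rfl⟩ (by rintro b hb; simp [Arg.subs] at hb)
  | df subs φ hs h ih =>
    intro he
    have : (subs.map Arg.concl, φ) ∈ DR L (.node .df subs φ) := ⟨subs, Sub.refl _, rfl⟩
    rw [he] at this
    exact absurd this (by simp)
  | cb subs φ hs h ih =>
    intro he
    refine JS.Strict.mk _ _ ⟨Or.inr rfl, rfl⟩ ?_
    rintro ⟨b, hb⟩ hbm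
    refine ih b hbm ?_
    rw [Set.eq_empty_iff_forall_notMem] at he ⊢
    rintro r ⟨s, hsb, hr⟩
    exact he r ⟨s, hsb.trans' (sub_of_mem hbm), hr⟩

theorem subC_list {L : Logic} {as : ASys L} {x : Arg L} (hx : Wf L as x) :
    ∃ l : List L.F, ∀ χ, χ ∈ l ↔ χ ∈ SubC L x := by
  have : (SubC L x).Finite := (sub_finite hx).image Arg.concl
  exact ⟨this.toFinset.toList, by simp⟩

section main

variable {L : Logic} {as : ASys L} {Lb : WfArg L as → JS.Lab}

theorem in_of_DR (hadm : JS.Admissible (toJ L as) Lb) (x : WfArg L as) (h : DR L x.1 = ∅) :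
    Lb x = JS.Lab.IN := hadm.2.2 x (strict_of_DR x.2 h)

theorem in_of_ax (hadm : JS.Admissible (toJ L as) Lb) (x : WfArg L as) (h : x.1.kind = RK.ax) :
    Lb x = JS.Lab.IN := by
  apply in_of_DR hadm
  obtain ⟨x, hx⟩ := x
  cases hx with
  | ax φ _ =>
    rw [Set.eq_empty_iff_forall_notMem]
    rintro r ⟨s, hs, hr⟩
    rcases sub_node.1 hs with h | ⟨b, hb, _⟩
    · cases h
    · simp at hb
  | cb => cases h
  | df => cases h

/-- The join of two arguments by a consequence-based rule. -/
def join2 (e f : WfArg L as) : WfArg L as :=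
  ⟨.node .cb [e.1, f.1] e.1.concl, Wf.cb _ _ (by
    intro a ha
    simp at ha
    rcases ha with rfl | rfl
    · exact e.2
    · exact f.2) (fun i hi => hi _ ⟨e.1, by simp, rfl⟩)⟩

theorem sub_join2_left {e f : WfArg L as} {z : Arg L} (h : Sub L z e.1) :
    Sub L z (join2 e f).1 := Sub.step _ e.1 _ _ _ (by simp) h

theorem sub_join2_right {e f : WfArg L as} {z : Arg L} (h : Sub L z f.1) :
    Sub L z (join2 e f).1 := Sub.step _ f.1 _ _ _ (by simp) h

theorem join2_supp (e f : WfArg L as) : (toJ L as).supp {e, f} (join2 e f) := by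
  refine ⟨Or.inr rfl, ?_⟩
  ext d
  simp only [join2, Arg.subs, Set.mem_insert_iff, Set.mem_singleton_iff, Set.mem_setOf_eq,
    List.mem_cons, List.not_mem_nil, or_false]
  exact or_congr Subtype.ext_iff Subtype.ext_iff

theorem join2_in (hadm : JS.Admissible (toJ L as) Lb) {e f : WfArg L as}
    (he : Lb e = JS.Lab.IN) (hf : Lb f = JS.Lab.IN) : Lb (join2 e f) = JS.Lab.IN := by
  have all : ∀ b ∈ ({e, f} : Set (WfArg L as)), Lb b = JS.Lab.IN := by
    rintro b (rfl | rfl) <;> assumption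
  have key : ∀ x ∈ ({e, f} : Set (WfArg L as)),
      (∀ b ∈ ({e, f} : Set (WfArg L as)), b ≠ x → (toJ L as).pref x b) →
      Lb (join2 e f) = JS.Lab.IN := by
    intro x hx hp
    rcases (hadm.1 x (all x hx)).2 _ _ (join2_supp e f) hx hp with
      h | ⟨_, b, hb, _, h⟩ | ⟨_, ⟨b, hb, _, h⟩ | ⟨b, hb, _, _, _, _, _, h, _⟩⟩
    · exact h
    · rw [all b hb] at h; simp at h
    · rw [all b hb] at h; simp at h
    · rw [all b hb] at h; simp at h
  rcases ewl_total e.2 f.2 with h | h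
  · apply key e (by simp)
    rintro b (rfl | rfl) hb
    · exact absurd rfl hb
    · exact h
  · apply key f (by simp)
    rintro b (rfl | rfl) hb
    · exact h
    · exact absurd rfl hb

/-- e covers x: all axiomatic and defeasible sub-arguments of x are sub-arguments of e. -/
def Cov (e x : WfArg L as) : Prop := ∀ z, Sub L z x.1 → z.kind ≠ RK.cb → Sub L z e.1

/-- The new IN-set. -/
def NewIn (Lb : WfArg L as → JS.Lab) (x : WfArg L as) : Prop :=
  ∃ e, Lb e = JS.Lab.IN ∧ Cov e x

theorem newIn_of_in {x : WfArg L as} (h : Lb x = JS.Lab.IN) : NewIn Lb x :=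
  ⟨x, h, fun _ hz _ => hz⟩

theorem cover_list (hadm : JS.Admissible (toJ L as) Lb) (e0 : WfArg L as)
    (h0 : Lb e0 = JS.Lab.IN) (P : Arg L → Prop)
    (l : List (Arg L)) (hl : ∀ d : WfArg L as, d.1 ∈ l → P d.1 → NewIn Lb d)
    (hw : ∀ d ∈ l, Wf L as d) :
    ∃ e, Lb e = JS.Lab.IN ∧ (∀ z, Sub L z e0.1 → Sub L z e.1) ∧
      ∀ d : WfArg L as, d.1 ∈ l → P d.1 → Cov e d := by
  induction l with
  | nil => exact ⟨e0, h0, fun _ h => h, by simp⟩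
  | cons d l ih =>
    obtain ⟨e, he, hs, hc⟩ := ih (fun d hd => hl d (by simp [hd])) (fun d hd => hw d (by simp [hd]))
    by_cases hP : P d
    · obtain ⟨f, hf, hfc⟩ := hl ⟨d, hw d (by simp)⟩ (by simp) hP
      refine ⟨join2 e f, join2_in hadm he hf, fun z hz => sub_join2_left (hs z hz), ?_⟩
      intro d' hd' hP'
      rcases List.mem_cons.1 hd' with h | h
      · intro z hz hk
        exact sub_join2_right (hfc z (by rw [h] at hz; exact hz) hk)
      · exact fun z hz hk => sub_join2_left (hc d' h hP' z hz hk)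
    · refine ⟨e, he, hs, ?_⟩
      intro d' hd' hP'
      rcases List.mem_cons.1 hd' with h | h
      · exact absurd (h ▸ hP') hP
      · exact hc d' h hP'

theorem wf_subs (b : WfArg L as) : ∀ d ∈ b.1.subs, Wf L as d :=
  fun _ hd => b.2.sub (sub_of_mem hd)

/-- A tautological strict argument. -/
def taut (x : WfArg L as) : WfArg L as :=
  ⟨.node .cb [] (L.neg (L.conj x.1.concl (L.neg x.1.concl))), Wf.cb _ _ (by simp) (by
    intro i _
    rw [L.neg_spec, L.conj_spec, L.neg_spec]
    tauto)⟩

theorem DR_cb_nil (φ : L.F) : DR L (.node .cb [] φ) = ∅ := by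
  rw [Set.eq_empty_iff_forall_notMem]
  rintro r ⟨s, hs, hr⟩
  rcases sub_node.1 hs with h | ⟨b, hb, _⟩
  · cases h
  · simp at hb

theorem newIn_closed (hadm : JS.Admissible (toJ L as) Lb) {S : Set (WfArg L as)} {c : WfArg L as}
    (hs : (toJ L as).supp S c) (h : ∀ d ∈ S, NewIn Lb d) : NewIn Lb c := by
  obtain ⟨hk | hk, rfl⟩ := hs
  · exact newIn_of_in (in_of_ax hadm c hk)
  · obtain ⟨e, he, -, hc⟩ := cover_list hadm (taut c) (in_of_DR hadm _ (DR_cb_nil _))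
      (fun _ => True) c.1.subs (fun d hd _ => h d hd) (wf_subs c)
    refine ⟨e, he, ?_⟩
    intro z hz hzk
    obtain ⟨d, hd, hzd⟩ := sub_ad hk hz hzk
    exact hc ⟨d, wf_subs c d hd⟩ hd trivial z hzd hzk

/-- Extending a legal OUT justification along a support. -/
theorem out_shift {A : Type} {J : JS.JSBAF A} {M : A → JS.Lab} {S : Set A} {x b : A}
    (hs : J.supp S b) (hx : x ∈ S) (hd : ∀ d ∈ S, d ≠ x → M d = JS.Lab.IN)
    (hp : ∀ d ∈ S, d ≠ x → J.pref x d) (hbo : M b = JS.Lab.OUT)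
    (hb : JS.legallyOut J M b) : JS.legallyOut J M x := by
  rcases hb with ⟨c, hc, hci⟩ | ⟨n, T, g, h1, h2, h3, h4, h5, h6, h7, h8⟩
  · refine Or.inr ⟨0, fun _ => S, fun _ => b, fun _ _ => hs, by simp, hx, hd, ⟨c, hc, hci⟩,
      fun _ _ => hbo, ?_, hp⟩
    intro i hi1 hi2
    omega
  · refine Or.inr ⟨n + 1, fun i => match i with | 0 => S | j + 1 => T j,
      fun i => match i with | 0 => b | j + 1 => g j, ?_, ?_, hx, hd, h5, ?_, ?_, hp⟩
    · rintro (_ | i) hi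
      · exact hs
      · exact h1 i (by omega)
    · rintro (_ | i) hi
      · exact h3
      · exact h2 i (by omega)
    · rintro (_ | i) hi
      · exact hbo
      · exact h6 i (by omega)
    · rintro (_ | _ | i) hi1 hi2
      · omega
      · exact h4
      · exact h7 (i + 1) (by omega) (by omega)

theorem att_new_out (hadm : JS.Admissible (toJ L as) Lb) {c x : WfArg L as} (hx : NewIn Lb x)
    (h : (toJ L as).att c x) : Lb c = JS.Lab.OUT := by
  obtain ⟨e, he, hcov⟩ := hx
  have hatt := (hadm.1 e he).1
  rcases h with ⟨s, φ, hs, hn⟩ | ⟨⟨hne, φ, l, hl, hcc⟩, hpref⟩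
  · exact hatt c (Or.inl ⟨s, φ, hcov _ hs (by simp [Arg.kind]), hn⟩)
  · obtain ⟨m, hm⟩ := subC_list e.2
    have hsub : DR L x.1 ⊆ DR L e.1 := DR_mono_cov hcov
    have hwf : Wf L as (.node .cb [c.1] (L.neg (conjL L e.1.concl m))) := by
      refine Wf.cb _ _ (by simpa using c.2) ?_
      intro i hi
      have h1 := hi _ ⟨c.1, by simp, rfl⟩
      rw [hcc, L.neg_spec, models_conjL] at h1
      rw [L.neg_spec, models_conjL]
      intro h2
      apply h1
      intro χ hχ
      refine sound_subC x.2 i ?_ χ (hl χ hχ)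
      intro z hz hk
      exact h2 _ (List.mem_cons_of_mem _ ((hm _).2 ⟨z, hcov z hz hk, rfl⟩))
    let cs : WfArg L as := ⟨_, hwf⟩
    have hDR : DR L cs.1 = DR L c.1 := by
      apply Set.Subset.antisymm
      · apply DR_mono_cov
        intro z hz hk
        obtain ⟨d, hd, hzd⟩ := sub_ad (b := cs.1) rfl hz hk
        have : d = c.1 := by simpa [cs, Arg.subs] using hd
        rwa [this] at hzd
      · exact DR_mono_cov (fun z hz _ => Sub.step _ c.1 _ _ _ (by simp) hz)
    have hout : Lb cs = JS.Lab.OUT := by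
      apply hatt
      have hene : DR L e.1 ≠ ∅ := fun h => hne (Set.subset_empty_iff.1 (h ▸ hsub))
      refine Or.inr ⟨⟨hene, e.1.concl, m, ?_, rfl⟩, ?_⟩
      · intro χ hχ
        rcases List.mem_cons.1 hχ with rfl | hχ
        · exact ⟨e.1, Sub.refl _, rfl⟩
        · exact (hm χ).1 hχ
      · rintro ⟨h1, h2⟩
        unfold ewl at h1 h2 hpref
        rw [hDR] at h1 h2
        apply hpref
        constructor
        · rcases h1 with h1 | ⟨r, hr, h1⟩
          · exact absurd h1.2 hene
          · exact Or.inr ⟨r, hr, fun r' hr' => h1 r' (hsub hr')⟩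
        · rintro (h3 | ⟨r, hr, h3⟩)
          · exact hne h3.1
          · exact h2 (Or.inr ⟨r, hsub hr, h3⟩)
    have hS : ∀ d ∈ ({c} : Set (WfArg L as)), d = c := fun d hd => hd
    refine (hadm.2.1 c).2 (out_shift (S := {c}) (b := cs) ⟨Or.inr rfl, ?_⟩ rfl
      (fun d hd hne => absurd (hS d hd) hne) (fun d hd hne => absurd (hS d hd) hne) hout
      ((hadm.2.1 cs).1 hout))
    ext d
    simp only [cs, Arg.subs, Set.mem_singleton_iff, Set.mem_setOf_eq, List.mem_singleton]
    exact Subtype.ext_iff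

theorem newIn_not_out (hadm : JS.Admissible (toJ L as) Lb) {y : WfArg L as} (hy : NewIn Lb y) :
    Lb y ≠ JS.Lab.OUT := by
  intro ho
  rcases (hadm.2.1 y).1 ho with ⟨c, hc, hci⟩ | ⟨n, T, g, h1, h2, h3, h4, ⟨c, hc, hci⟩, h6, h7, h8⟩
  · rw [att_new_out hadm hy hc] at hci
    cases hci
  · have : ∀ i ≤ n, NewIn Lb (g i) := by
      intro i
      induction i with
      | zero =>
        intro hi
        refine newIn_closed hadm (h1 0 hi) ?_
        intro d hd
        by_cases hdy : d = y
        · rw [hdy]; exact hy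
        · exact newIn_of_in (h4 d hd hdy)
      | succ i ih =>
        intro hi
        refine newIn_closed hadm (h1 (i + 1) hi) ?_
        intro d hd
        by_cases hdy : d = g i
        · rw [hdy]; exact ih (by omega)
        · exact newIn_of_in (h7 (i + 1) (by omega) hi d hd hdy)
    rw [att_new_out hadm (this n le_rfl) hc] at hci
    cases hci

/-- The new OUT-set. -/
inductive NewOut (Lb : WfArg L as → JS.Lab) : WfArg L as → Prop
  | base (x : WfArg L as) (h : Lb x = JS.Lab.OUT) : NewOut Lb x
  | att (x y : WfArg L as) (hy : NewIn Lb y) (h : (toJ L as).att y x) : NewOut Lb x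
  | supp (x b : WfArg L as) (S : Set (WfArg L as)) (hs : (toJ L as).supp S b) (hx : x ∈ S)
      (hd : ∀ d ∈ S, d ≠ x → NewIn Lb d) (hp : ∀ d ∈ S, d ≠ x → (toJ L as).pref x d)
      (hb : NewOut Lb b) : NewOut Lb x

theorem newOut_not_newIn (hadm : JS.Admissible (toJ L as) Lb) {x : WfArg L as}
    (h : NewOut Lb x) : ¬ NewIn Lb x := by
  induction h with
  | base x h => exact fun hx => newIn_not_out hadm hx h
  | att x y hy h => exact fun hx => newIn_not_out hadm hy (att_new_out hadm hx h)
  | supp x b S hs hx hd hp hb ih =>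
    intro hxi
    refine ih (newIn_closed hadm hs fun d hdS => ?_)
    by_cases hdx : d = x
    · rw [hdx]; exact hxi
    · exact hd d hdS hdx

/-- c is covered by an IN-argument that is at most as strong as b, together with b. -/
def Cov2 (Lb : WfArg L as → JS.Lab) (b c : WfArg L as) : Prop :=
  ∃ e, Lb e = JS.Lab.IN ∧ (∃ r ∈ DR L e.1, ∀ r' ∈ DR L b.1, as.rpref r r') ∧
    ∀ z, Sub L z c.1 → z.kind ≠ RK.cb → Sub L z e.1 ∨ Sub L z b.1

theorem cov2_step (hadm : JS.Admissible (toJ L as) Lb) {b c g : WfArg L as}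
    {S : Set (WfArg L as)} (h : Cov2 Lb b c) (hs : (toJ L as).supp S g)
    (hd : ∀ d ∈ S, d ≠ c → NewIn Lb d) (hg : ¬ NewIn Lb g) : Cov2 Lb b g := by
  obtain ⟨e, he, ⟨r, hr, hrb⟩, hc⟩ := h
  obtain ⟨hk | hk, rfl⟩ := hs
  · exact absurd (newIn_of_in (in_of_ax hadm g hk)) hg
  · obtain ⟨f, hf, hef, hfc⟩ := cover_list hadm e he (fun d => d ≠ c.1) g.1.subs
      (fun d hdm hne => hd d hdm (fun h => hne (by rw [h]))) (wf_subs g)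
    refine ⟨f, hf, ⟨r, DR_mono_cov (fun z hz _ => hef z hz) hr, hrb⟩, ?_⟩
    intro z hz hzk
    obtain ⟨d, hdm, hzd⟩ := sub_ad hk hz hzk
    by_cases hdc : d = c.1
    · rw [hdc] at hzd
      exact (hc z hzd hzk).imp_left (hef z)
    · exact Or.inl (hfc ⟨d, wf_subs g d hdm⟩ hdm hdc z hzd hzk)

theorem cov2_att (hadm : JS.Admissible (toJ L as) Lb) {b c y : WfArg L as} (hbn : ¬ NewIn Lb b)
    (h : Cov2 Lb b c) (hy : NewIn Lb y) (hatt : (toJ L as).att y c) : NewOut Lb b := by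
  obtain ⟨e, he, ⟨r, hr, hrb⟩, hc⟩ := h
  rcases hatt with ⟨s, φ, hs, hn⟩ | ⟨⟨hne, φ, l, hl, hcc⟩, -⟩
  · rcases hc _ hs (by simp [Arg.kind]) with h | h
    · exact absurd (att_new_out hadm (newIn_of_in he) (Or.inl ⟨s, φ, h, hn⟩))
        (newIn_not_out hadm hy)
    · exact NewOut.att _ y hy (Or.inl ⟨s, φ, h, hn⟩)
  · obtain ⟨f, hf, hfy⟩ := hy
    let g := join2 e f
    have hg : Lb g = JS.Lab.IN := join2_in hadm he hf
    let k := join2 g b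
    obtain ⟨m, hm⟩ := subC_list k.2
    have hwf : Wf L as (.node .cb [] (L.neg (conjL L k.1.concl m))) := by
      refine Wf.cb _ _ (by simp) ?_
      intro i _
      rw [L.neg_spec, models_conjL]
      intro h2
      have h3 : ∀ z, Sub L z k.1 → L.Models i z.concl := fun z hz =>
        h2 _ (List.mem_cons_of_mem _ ((hm _).2 ⟨z, hz, rfl⟩))
      have h4 : L.Models i y.1.concl := sound_concl y.2 i fun z hz hzk =>
        h3 z (sub_join2_left (sub_join2_right (hfy z hz hzk)))
      rw [hcc, L.neg_spec, models_conjL] at h4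
      apply h4
      intro χ hχ
      refine sound_subC c.2 i ?_ χ (hl χ hχ)
      intro z hz hzk
      rcases hc z hz hzk with h | h
      · exact h3 z (sub_join2_left (sub_join2_left h))
      · exact h3 z (sub_join2_right h)
    have hrg : r ∈ DR L g.1 := DR_mono_cov (fun z hz _ => sub_join2_left hz) hr
    have hrk : r ∈ DR L k.1 := DR_mono_cov (fun z hz _ => sub_join2_left hz) hrg
    have hkne : DR L k.1 ≠ ∅ := fun h => by rw [h] at hrk; exact hrk
    have hko : Lb k = JS.Lab.OUT := by
      refine (hadm.2.1 k).2 (Or.inl ⟨⟨_, hwf⟩, ?_, in_of_DR hadm _ (DR_cb_nil _)⟩)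
      refine Or.inr ⟨⟨hkne, k.1.concl, m, ?_, rfl⟩, ?_⟩
      · intro χ hχ
        rcases List.mem_cons.1 hχ with rfl | hχ
        · exact ⟨k.1, Sub.refl _, rfl⟩
        · exact (hm χ).1 hχ
      · rintro ⟨h1 | ⟨r, hr, -⟩, -⟩
        · exact hkne h1.2
        · rw [DR_cb_nil] at hr; exact hr
    have hmem : ∀ d ∈ ({g, b} : Set (WfArg L as)), d ≠ g → d = b := by
      rintro d (h | h) hd
      · exact absurd h hd
      · exact h
    rcases (hadm.1 g hg).2 _ _ (join2_supp g b) (by simp)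
      (fun d hd hdg => by rw [hmem d hd hdg]; exact Or.inr ⟨r, hrg, hrb⟩) with
      h | ⟨h, _⟩ | ⟨_, ⟨d, hd, hdg, h⟩ | ⟨d, hd, d', hd', h1, h2, h3, _⟩⟩
    · rw [hko] at h; cases h
    · rw [hko] at h; cases h
    · rw [hmem d hd hdg] at h
      exact NewOut.base _ h
    · exact absurd ((hmem d hd h1).trans (hmem d' hd' h2).symm) h3

theorem cov2_out (hadm : JS.Admissible (toJ L as) Lb) {b c : WfArg L as} (hbn : ¬ NewIn Lb b)
    (ho : NewOut Lb c) (h : Cov2 Lb b c) : NewOut Lb b := by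
  induction ho with
  | att c y hy hatt => exact cov2_att hadm hbn h hy hatt
  | supp c g S hs hx hd hp hg ih =>
    exact ih (cov2_step hadm h hs hd (newOut_not_newIn hadm hg))
  | base c ho =>
    rcases (hadm.2.1 c).1 ho with
      ⟨y, hy, hyi⟩ | ⟨n, T, g, h1, h2, h3, h4, ⟨y, hy, hyi⟩, h6, h7, h8⟩
    · exact cov2_att hadm hbn h (newIn_of_in hyi) hy
    · have : ∀ i ≤ n, Cov2 Lb b (g i) := by
        intro i
        induction i with
        | zero =>
          intro hi
          exact cov2_step hadm h (h1 0 hi) (fun d hd hdc => newIn_of_in (h4 d hd hdc))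
            (fun hn => newIn_not_out hadm hn (h6 0 hi))
        | succ i ih =>
          intro hi
          exact cov2_step hadm (ih (by omega)) (h1 (i + 1) hi)
            (fun d hd hdc => newIn_of_in (h7 (i + 1) (by omega) hi d hd hdc))
            (fun hn => newIn_not_out hadm hn (h6 _ hi))
      exact cov2_att hadm hbn (this n le_rfl) (newIn_of_in hyi) hy

open Classical in
/-- The new labeling. -/
noncomputable def newLab (Lb : WfArg L as → JS.Lab) (x : WfArg L as) : JS.Lab :=
  if NewIn Lb x then JS.Lab.IN else if NewOut Lb x then JS.Lab.OUT else JS.Lab.UNDEC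

theorem newLab_in {x : WfArg L as} : newLab Lb x = JS.Lab.IN ↔ NewIn Lb x := by
  unfold newLab
  split_ifs <;> simp_all

theorem newLab_out (hadm : JS.Admissible (toJ L as) Lb) {x : WfArg L as} :
    newLab Lb x = JS.Lab.OUT ↔ NewOut Lb x := by
  have := newOut_not_newIn hadm (x := x)
  unfold newLab
  split_ifs <;> simp_all

theorem newLab_adm (hadm : JS.Admissible (toJ L as) Lb) :
    JS.Admissible (toJ L as) (newLab Lb) := by
  refine ⟨?_, ?_, ?_⟩
  · intro x hx
    rw [newLab_in] at hx
    refine ⟨fun c hc => (newLab_out hadm).2 (NewOut.base _ (att_new_out hadm hx hc)), ?_⟩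
    intro S c hs hxS hp
    by_cases hall : ∀ d ∈ S, NewIn Lb d
    · exact Or.inl (newLab_in.2 (newIn_closed hadm hs hall))
    push Not at hall
    obtain ⟨b, hbS, hbn⟩ := hall
    have hbx : b ≠ x := fun h => hbn (h ▸ hx)
    cases hcl : newLab Lb c with
    | IN => exact Or.inl rfl
    | UNDEC =>
      refine Or.inr (Or.inl ⟨rfl, b, hbS, hbx, ?_⟩)
      cases hbl : newLab Lb b with
      | IN => exact absurd (newLab_in.1 hbl) hbn
      | OUT => exact Or.inl rfl
      | UNDEC => exact Or.inr rfl
    | OUT =>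
      refine Or.inr (Or.inr ⟨rfl, ?_⟩)
      by_contra hcon
      push Not at hcon
      obtain ⟨hc1, hc2⟩ := hcon
      have hund : ∀ d ∈ S, ¬ NewIn Lb d → newLab Lb d = JS.Lab.UNDEC := by
        intro d hd hdn
        cases hdl : newLab Lb d with
        | IN => exact absurd (newLab_in.1 hdl) hdn
        | OUT => exact absurd hdl (hc1 d hd (fun h => hdn (h ▸ hx)))
        | UNDEC => rfl
      have hothers : ∀ d ∈ S, d ≠ b → NewIn Lb d := by
        intro d hd hdb
        by_contra hdn
        exact hc2 d hd b hbS (fun h => hdn (h ▸ hx)) hbx hdb (hund d hd hdn) (hund b hbS hbn)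
      have hco := (newLab_out hadm).1 hcl
      have hxb : ∃ r ∈ DR L x.1, ∀ r' ∈ DR L b.1, as.rpref r r' := by
        rcases hp b hbS hbx with h | h
        · exact absurd (newIn_of_in (in_of_DR hadm b h.2)) hbn
        · exact h
      obtain ⟨r, hr, hrb⟩ := hxb
      obtain ⟨e, he, hex⟩ := hx
      have hcov : Cov2 Lb b b := ⟨e, he, ⟨r, DR_mono_cov hex hr, hrb⟩, fun z hz _ => Or.inr hz⟩
      have hbo := cov2_out hadm hbn hco
        (cov2_step hadm hcov hs hothers (newOut_not_newIn hadm hco))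
      exact hc1 b hbS hbx ((newLab_out hadm).2 hbo)
  · intro x
    rw [newLab_out hadm]
    constructor
    · intro h
      induction h with
      | base x h =>
        have hI : ∀ z, Lb z = JS.Lab.IN → newLab Lb z = JS.Lab.IN :=
          fun z hz => newLab_in.2 (newIn_of_in hz)
        have hO : ∀ z, Lb z = JS.Lab.OUT → newLab Lb z = JS.Lab.OUT :=
          fun z hz => (newLab_out hadm).2 (NewOut.base _ hz)
        rcases (hadm.2.1 x).1 h with
          ⟨y, hy, hyi⟩ | ⟨n, T, g, h1, h2, h3, h4, ⟨y, hy, hyi⟩, h6, h7, h8⟩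
        · exact Or.inl ⟨y, hy, hI y hyi⟩
        · exact Or.inr ⟨n, T, g, h1, h2, h3, fun d hd hn => hI _ (h4 d hd hn), ⟨y, hy, hI _ hyi⟩,
            fun i hi => hO _ (h6 i hi), fun i hi hi' d hd hn => hI _ (h7 i hi hi' d hd hn), h8⟩
      | att x y hy h => exact Or.inl ⟨y, h, newLab_in.2 hy⟩
      | supp x b S hs hx hd hp hb ih =>
        exact out_shift hs hx (fun d hdS hn => newLab_in.2 (hd d hdS hn)) hp
          ((newLab_out hadm).2 hb) ih
    · rintro (⟨y, hy, hyi⟩ | ⟨n, T, g, h1, h2, h3, h4, h5, h6, h7, h8⟩)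
      · exact NewOut.att _ y (newLab_in.1 hyi) hy
      · exact NewOut.supp _ (g 0) (T 0) (h1 0 (Nat.zero_le _)) h3
          (fun d hd hn => newLab_in.1 (h4 d hd hn)) h8
          ((newLab_out hadm).1 (h6 0 (Nat.zero_le _)))
  · intro x hx
    exact newLab_in.2 (newIn_of_in (hadm.2.2 x hx))

end main

end ASPIC

open ASPIC in
/-- Every preferred labeling of the JSBAF corresponding to a Deductive ASPIC⊖
argumentation system is closed under sub-arguments. -/
theorem preferred_closed_under_subarguments (L : Logic) (as : ASys L)
    (Lb : WfArg L as → JS.Lab) (hpr : JS.Preferred (toJ L as) Lb) :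
    ∀ a a' : WfArg L as, Sub L a'.1 a.1 → Lb a = JS.Lab.IN → Lb a' = JS.Lab.IN := by
  intro a a' hsub ha
  by_contra hcon
  refine hpr.2 (newLab Lb) (newLab_adm hpr.1) ⟨fun x hx => newLab_in.2 (newIn_of_in hx), ?_⟩
  intro hss
  exact hcon (hss (newLab_in.2 ⟨a, ha, fun z hz _ => hz.trans' hsub⟩))
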